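/- Under the Kähler cvc(1) package described in the context, if dim V ≥ 6, then there exists μ > 0 such that A∘A = -μ²·id; equivalently, ‖Av‖ = μ for every unit vector v ∈ V. -/

import Mathlib

open scoped RealInnerProductSpace

section CurvatureTensor

variable {V : Type*} [NormedAddCommGroup V] [InnerProductSpace ℝ V]

/-- If the curvature-one Jacobi eigenspace of `R` at `v` contains the orthogonal complement of
`span {v, A v}`, then the Jacobi operator of `R` at `v` differs from that of constant curvature one
by a multiple of the square of the linear form `⟪A v, ·⟫`. -/
lemma exists_jacobi_eq (R : V →ₗ[ℝ] V →ₗ[ℝ] V →ₗ[ℝ] V →ₗ[ℝ] ℝ) (A : V →ₗ[ℝ] V)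
    (hskew : ∀ X Y Z W : V, R X Y Z W = - R Y X Z W)
    (hpair : ∀ X Y Z W : V, R X Y Z W = R Z W X Y)
    (hAinj : Function.Injective A)
    (hAskew : ∀ x y : V, ⟪A x, y⟫ = -⟪x, A y⟫)
    (hE : ∀ v : V, ‖v‖ = 1 → ∀ w ∈ (Submodule.span ℝ {v, A v})ᗮ, ∀ u : V, R w v v u = ⟪w, u⟫)
    {v : V} (hv : v ≠ 0) :
    ∃ c : ℝ, ∀ w u : V,
      R w v v u = ⟪v, v⟫ * ⟪w, u⟫ - ⟪v, w⟫ * ⟪v, u⟫ + c * (⟪A v, w⟫ * ⟪A v, u⟫) := by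
  have hvA : ⟪v, A v⟫ = 0 := by linarith [hAskew v v, real_inner_comm v (A v)]
  have hAv : A v ≠ 0 := (map_ne_zero_iff A hAinj).2 hv
  have hn : ⟪v, v⟫ ≠ 0 := inner_self_ne_zero.2 hv
  have hm : ⟪A v, A v⟫ ≠ 0 := inner_self_ne_zero.2 hAv
  have hvv : ∀ u, R v v v u = 0 := fun u => by linarith [hskew v v v u]
  have hsymm : ∀ w u, R w v v u = R u v v w := fun w u => by
    rw [hpair w v v u, hskew v u w v, hpair u v w v, hskew w v u v, hpair v w u v, hpair u v v w,
      neg_neg]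
  have hker : ∀ w : V, ⟪v, w⟫ = 0 → ⟪A v, w⟫ = 0 → ∀ u, R w v v u = ⟪v, v⟫ * ⟪w, u⟫ := by
    intro w hw hw' u
    have hr : ‖v‖ ≠ 0 := norm_ne_zero_iff.2 hv
    have h1 : ‖(‖v‖⁻¹ • v)‖ = 1 := norm_smul_inv_norm hv
    have h := hE _ h1 w (by
      rw [Submodule.mem_orthogonal]
      intro z hz
      rw [Submodule.mem_span_pair] at hz
      obtain ⟨a, b, rfl⟩ := hz
      simp [inner_add_left, inner_smul_left, hw, hw']) u
    simp only [map_smul, LinearMap.smul_apply, smul_eq_mul] at h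
    rw [real_inner_self_eq_norm_sq, ← h]
    field_simp
  have hdecomp : ∀ w u, R w v v u = ⟪v, v⟫ * ⟪w, u⟫ - ⟪v, w⟫ * ⟪v, u⟫
      + ⟪A v, w⟫ / ⟪A v, A v⟫ * (R (A v) v v u - ⟪v, v⟫ * ⟪A v, u⟫) := by
    intro w u
    have h := hker (w + (-(⟪v, w⟫ / ⟪v, v⟫)) • v + (-(⟪A v, w⟫ / ⟪A v, A v⟫)) • A v)
      (by simp only [inner_add_right, inner_smul_right, hvA]; field_simp; ring)
      (by simp only [inner_add_right, inner_smul_right, real_inner_comm, hvA]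
          rw [real_inner_comm]; field_simp; ring) u
    simp only [map_add, map_smul, LinearMap.add_apply, LinearMap.smul_apply, smul_eq_mul, hvv,
      mul_zero, add_zero, inner_add_left, real_inner_smul_left] at h
    field_simp at h ⊢
    linarith
  refine ⟨(R (A v) v v (A v) - ⟪v, v⟫ * ⟪A v, A v⟫) / ⟪A v, A v⟫ ^ 2, fun w u => ?_⟩
  rw [hdecomp w u, hsymm (A v) u, hdecomp u (A v), hvA, real_inner_comm (A v) u]
  field_simp
  ring

/-- An algebraic curvature tensor is determined by its Jacobi operators: if they are those of
constant curvature one plus `c` times the square of `⟪A v, ·⟫`, the tensor is explicit. -/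
lemma curvature_eq_of_jacobi_eq (R : V →ₗ[ℝ] V →ₗ[ℝ] V →ₗ[ℝ] V →ₗ[ℝ] ℝ) (A : V →ₗ[ℝ] V) (c : ℝ)
    (hskew : ∀ X Y Z W : V, R X Y Z W = - R Y X Z W)
    (hbianchi : ∀ X Y Z W : V, R X Y Z W + R Y Z X W + R Z X Y W = 0)
    (hAskew : ∀ x y : V, ⟪A x, y⟫ = -⟪x, A y⟫)
    (hjac : ∀ v w u : V,
      R w v v u = ⟪v, v⟫ * ⟪w, u⟫ - ⟪v, w⟫ * ⟪v, u⟫ + c * (⟪A v, w⟫ * ⟪A v, u⟫))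
    (x y z w : V) :
    R x y z w = ⟪y, z⟫ * ⟪x, w⟫ - ⟪x, z⟫ * ⟪y, w⟫
      + c / 3 * (⟪A y, z⟫ * ⟪A x, w⟫ - ⟪A x, z⟫ * ⟪A y, w⟫ - 2 * (⟪A x, y⟫ * ⟪A z, w⟫)) := by
  have hpol : ∀ x y z, R x y z w + R x z y w =
      2 * ⟪y, z⟫ * ⟪x, w⟫ - ⟪y, x⟫ * ⟪z, w⟫ - ⟪z, x⟫ * ⟪y, w⟫
        + c * (⟪A y, x⟫ * ⟪A z, w⟫ + ⟪A z, x⟫ * ⟪A y, w⟫) := by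
    intro x y z
    have h := hjac (y + z) x w
    simp only [map_add, LinearMap.add_apply, inner_add_left, inner_add_right] at h
    rw [real_inner_comm y z] at h
    linarith [hjac y x w, hjac z x w]
  have hswap : ∀ a b : V, ⟪A a, b⟫ = -⟪A b, a⟫ := fun a b => by
    rw [hAskew, real_inner_comm]
  have h1 := hpol y z x
  have h2 := hpol x z y
  rw [real_inner_comm y x, real_inner_comm y z, hswap x y] at *
  rw [real_inner_comm x z, hswap z y, hswap z x] at *
  linarith [hbianchi x y z w, hskew z x y w, hskew y x z w]

/-- If the Jacobi operators of a curvature tensor have the form of `exists_jacobi_eq`, the factor in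
front of the square of `⟪A v, ·⟫` does not depend on `v`. -/
lemma exists_forall_jacobi_eq (R : V →ₗ[ℝ] V →ₗ[ℝ] V →ₗ[ℝ] V →ₗ[ℝ] ℝ) (A : V →ₗ[ℝ] V)
    (hskew : ∀ X Y Z W : V, R X Y Z W = - R Y X Z W)
    (hpair : ∀ X Y Z W : V, R X Y Z W = R Z W X Y)
    (hAinj : Function.Injective A)
    (hAskew : ∀ x y : V, ⟪A x, y⟫ = -⟪x, A y⟫)
    (hjac : ∀ v : V, v ≠ 0 → ∃ c : ℝ, ∀ w u : V,
      R w v v u = ⟪v, v⟫ * ⟪w, u⟫ - ⟪v, w⟫ * ⟪v, u⟫ + c * (⟪A v, w⟫ * ⟪A v, u⟫)) :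
    ∃ c : ℝ, ∀ v w u : V,
      R w v v u = ⟪v, v⟫ * ⟪w, u⟫ - ⟪v, w⟫ * ⟪v, u⟫ + c * (⟪A v, w⟫ * ⟪A v, u⟫) := by
  choose! f hf using hjac
  have hconst : ∀ v w : V, ⟪A v, w⟫ ≠ 0 → f v = f w := by
    intro v w h
    have hv : v ≠ 0 := by rintro rfl; simp at h
    have hw : w ≠ 0 := by rintro rfl; simp at h
    have hswap : ⟪A w, v⟫ = -⟪A v, w⟫ := by rw [hAskew, real_inner_comm]
    have h1 := hf v hv w w
    have h2 := hf w hw v v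
    rw [hpair v w w v, hskew w v v w, hskew v w v w, neg_neg, hpair, hskew v w w v, hskew w v w v,
      neg_neg, real_inner_comm v w, hswap] at *
    have h3 : (f v - f w) * (⟪A v, w⟫ * ⟪A v, w⟫) = 0 := by linarith
    exact sub_eq_zero.1 ((mul_eq_zero.1 h3).resolve_right (mul_self_ne_zero.2 h))
  have hall : ∀ v w : V, v ≠ 0 → w ≠ 0 → f v = f w := by
    intro v w hv hw
    have hAv : ⟪A v, A v⟫ ≠ 0 := inner_self_ne_zero.2 ((map_ne_zero_iff A hAinj).2 hv)
    have hAw : ⟪A w, A w⟫ ≠ 0 := inner_self_ne_zero.2 ((map_ne_zero_iff A hAinj).2 hw)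
    by_cases h : ⟪A v, A w⟫ = 0
    · have h1 : ⟪A v, A v + A w⟫ ≠ 0 := by rwa [inner_add_right, h, add_zero]
      have h2 : ⟪A w, A v + A w⟫ ≠ 0 := by
        rwa [inner_add_right, real_inner_comm, h, zero_add]
      exact (hconst v _ h1).trans (hconst w _ h2).symm
    · exact (hconst v _ h).trans (hconst w _ hAw).symm
  by_cases hV : ∃ v₀ : V, v₀ ≠ 0
  · obtain ⟨v₀, hv₀⟩ := hV
    refine ⟨f v₀, fun v w u => ?_⟩
    rcases eq_or_ne v 0 with rfl | hv
    · simp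
    · rw [hall v₀ v hv₀ hv, hf v hv]
  · push Not at hV
    exact ⟨0, fun v w u => by simp [hV v]⟩

/-- In dimension greater than four, any four vectors have a common nonzero orthogonal vector. -/
lemma exists_ne_zero_orthogonal_four [FiniteDimensional ℝ V] (hdim : 4 < Module.finrank ℝ V)
    (a b c d : V) :
    ∃ y : V, y ≠ 0 ∧ ⟪a, y⟫ = 0 ∧ ⟪b, y⟫ = 0 ∧ ⟪c, y⟫ = 0 ∧ ⟪d, y⟫ = 0 := by
  classical
  have hle : Module.finrank ℝ (Submodule.span ℝ (({a, b, c, d} : Finset V) : Set V)) ≤ 4 :=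
    (finrank_span_finset_le_card _).trans Finset.card_le_four
  have hsum := Submodule.finrank_add_finrank_orthogonal
    (Submodule.span ℝ (({a, b, c, d} : Finset V) : Set V))
  have hne : (Submodule.span ℝ (({a, b, c, d} : Finset V) : Set V))ᗮ ≠ ⊥ := by
    intro h
    rw [h, finrank_bot] at hsum
    omega
  obtain ⟨y, hy, hy0⟩ := Submodule.exists_mem_ne_zero_of_ne_bot hne
  rw [Submodule.mem_orthogonal] at hy
  refine ⟨y, hy0, ?_, ?_, ?_, ?_⟩ <;>
    exact hy _ (Submodule.subset_span (by simp))

/-- If a tensor of the form found in `curvature_eq_of_jacobi_eq` satisfies the Kähler identity, then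
`A x` is a multiple of `J x` for every `x`. -/
lemma exists_apply_eq_smul_of_kahler [FiniteDimensional ℝ V] (hdim : 4 < Module.finrank ℝ V)
    (J : V →ₗ[ℝ] V)
    (hJiso : ∀ x y : V, ⟪J x, J y⟫ = ⟪x, y⟫) (hJ2 : ∀ x : V, J (J x) = -x)
    (A : V →ₗ[ℝ] V) (hAskew : ∀ x y : V, ⟪A x, y⟫ = -⟪x, A y⟫)
    (R : V →ₗ[ℝ] V →ₗ[ℝ] V →ₗ[ℝ] V →ₗ[ℝ] ℝ)
    (hR : ∀ x y z w : V, R x y (J z) (J w) = R x y z w)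
    {k : ℝ} (hk : k ≠ 0)
    (hform : ∀ x y z w : V, R x y z w = ⟪y, z⟫ * ⟪x, w⟫ - ⟪x, z⟫ * ⟪y, w⟫
      + k * (⟪A y, z⟫ * ⟪A x, w⟫ - ⟪A x, z⟫ * ⟪A y, w⟫ - 2 * (⟪A x, y⟫ * ⟪A z, w⟫)))
    (x : V) : ∃ b : ℝ, A x = b • J x := by
  have hJl : ∀ a b : V, ⟪J a, b⟫ = -⟪a, J b⟫ := fun a b => by
    rw [← hJiso a (J b), hJ2, inner_neg_right, neg_neg]
  have hJself : ∀ a : V, ⟪a, J a⟫ = 0 := fun a => by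
    linarith [hJl a a, real_inner_comm a (J a)]
  have hAself : ∀ a : V, ⟪A a, a⟫ = 0 := fun a => by
    linarith [hAskew a a, real_inner_comm a (A a)]
  rcases eq_or_ne x 0 with rfl | hx
  · exact ⟨0, by simp⟩
  have hn : ⟪x, x⟫ ≠ 0 := inner_self_ne_zero.2 hx
  obtain ⟨b, p, hp, hpx, hpJx⟩ :
      ∃ b : ℝ, ∃ p : V, A x = b • J x + p ∧ ⟪x, p⟫ = 0 ∧ ⟪x, J p⟫ = 0 := by
    refine ⟨⟪A x, J x⟫ / ⟪x, x⟫, A x - (⟪A x, J x⟫ / ⟪x, x⟫) • J x, by abel, ?_, ?_⟩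
    · rw [inner_sub_right, inner_smul_right, hJself, real_inner_comm, hAself]
      simp
    · have h : ⟪x, J (A x)⟫ = -⟪A x, J x⟫ := by
        rw [real_inner_comm, hJl]
      rw [map_sub, map_smul, hJ2, inner_sub_right, inner_smul_right, inner_neg_right, h]
      field_simp
      ring
  refine ⟨b, ?_⟩
  rcases eq_or_ne p 0 with rfl | hp0
  · rw [hp, add_zero]
  exfalso
  have hm : ⟪p, p⟫ ≠ 0 := inner_self_ne_zero.2 hp0
  obtain ⟨y, hy0, hxy, hJxy, hpy, hJpy⟩ :=
    exists_ne_zero_orthogonal_four hdim x (J x) p (J p)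
  have hxJy : ⟪x, J y⟫ = 0 := by linarith [hJl x y]
  have hyp : ⟪y, p⟫ = 0 := by rw [real_inner_comm, hpy]
  have hyJp : ⟪y, J p⟫ = 0 := by rw [real_inner_comm, hJpy]
  have hAxy : ⟪A x, y⟫ = 0 := by
    rw [hp, inner_add_left, real_inner_smul_left, hJxy, hpy]
    simp
  have hAxp : ⟪A x, p⟫ = ⟪p, p⟫ := by
    rw [hp, inner_add_left, real_inner_smul_left, hJl, hpJx]
    simp
  have hAxJp : ⟪A x, J p⟫ = 0 := by
    rw [hp, inner_add_left, real_inner_smul_left, hJiso, hpx, hJself]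
    simp
  have hAy : ∃ s t : ℝ, ∀ w : V, ⟪A y, w⟫ = s * ⟪A x, w⟫ + t * ⟪A x, J w⟫ := by
    refine ⟨⟪A y, p⟫ / ⟪p, p⟫, -⟪A y, J p⟫ / ⟪p, p⟫, fun w => ?_⟩
    have h := hR x y p w
    rw [hform, hform, hyp, hyJp, hpx, hpJx, hAxp, hAxJp, hAxy] at h
    have h' : k * (⟪A y, J p⟫ * ⟪A x, J w⟫ - ⟪A y, p⟫ * ⟪A x, w⟫ + ⟪p, p⟫ * ⟪A y, w⟫) = 0 := by
      linarith
    have h'' := (mul_eq_zero.1 h').resolve_left hk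
    field_simp
    linarith
  obtain ⟨s, t, hst⟩ := hAy
  have h := hR x y y x
  rw [hform, hform, hJself, hxJy, hxy, hAxy, hst (J y), hst (J x), hJ2, hJ2, inner_neg_right,
    inner_neg_right, hAxy, hAself, hAself] at h
  have h0 : ⟪y, y⟫ * ⟪x, x⟫ = 0 := by linarith
  exact (mul_ne_zero (inner_self_ne_zero.2 hy0) hn) h0

/-- A linear map all of whose values `A x` are multiples of `J x`, where `J` is a complex
structure, is a multiple of `J`. -/
lemma exists_eq_smul_of_forall_apply_eq_smul (J A : V →ₗ[ℝ] V) (hJ2 : ∀ x : V, J (J x) = -x)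
    (h : ∀ x, ∃ b : ℝ, A x = b • J x) : ∃ b : ℝ, ∀ x, A x = b • J x := by
  obtain ⟨a, ha⟩ := LinearMap.exists_eq_smul_id_of_forall_notLinearIndependent
    (f := J ∘ₗ A) fun v hli => by
      obtain ⟨b, hb⟩ := h v
      have := LinearIndependent.pair_iff.1 hli b 1 (by simp [hb, hJ2])
      exact one_ne_zero this.2
  refine ⟨-a, fun x => ?_⟩
  have hx : J (A x) = a • x := by simpa using LinearMap.congr_fun ha x
  have hx' := congrArg J hx
  rw [hJ2, map_smul] at hx'
  rw [neg_smul, ← hx', neg_neg]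

end CurvatureTensor

/-- In the Kähler cvc(1) package with `dim V ≥ 6`, there is `μ > 0` with
`A∘A = -μ²·id`; equivalently, `‖Av‖ = μ` for every unit vector `v`. -/
theorem stmt_17
    {V : Type*} [NormedAddCommGroup V] [InnerProductSpace ℝ V] [FiniteDimensional ℝ V]
    (hdim : 6 ≤ Module.finrank ℝ V)
    (J : V →ₗ[ℝ] V)
    (hJiso : ∀ x y : V, ⟪J x, J y⟫ = ⟪x, y⟫)
    (hJ2 : ∀ x : V, J (J x) = -x)
    (R : V →ₗ[ℝ] V →ₗ[ℝ] V →ₗ[ℝ] V →ₗ[ℝ] ℝ)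
    (hskew : ∀ X Y Z W : V, R X Y Z W = - R Y X Z W)
    (hpair : ∀ X Y Z W : V, R X Y Z W = R Z W X Y)
    (hbianchi : ∀ X Y Z W : V, R X Y Z W + R Y Z X W + R Z X Y W = 0)
    (hkahler : ∀ X Y Z W : V, R (J X) (J Y) Z W = R X Y Z W)
    (hsec : ∀ x y : V, ‖x‖ = 1 → ‖y‖ = 1 → ⟪x, y⟫ = 0 → 1 ≤ R y x x y)
    (A : V →ₗ[ℝ] V) (hAinv : Function.Bijective A)
    (hAskew : ∀ x y : V, ⟪A x, y⟫ = -⟪x, A y⟫)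
    (hE : ∀ v : V, ‖v‖ = 1 → ∀ w : V,
      (⟪w, v⟫ = 0 ∧ ∀ u : V, R w v v u = ⟪w, u⟫) ↔
        w ∈ (Submodule.span ℝ {v, A v})ᗮ) :
    ∃ μ : ℝ, 0 < μ ∧ (∀ x : V, A (A x) = -(μ ^ 2) • x) ∧
      ∀ v : V, ‖v‖ = 1 → ‖A v‖ = μ := by
  have hjac := fun v hv => exists_jacobi_eq R A hskew hpair hAinv.1 hAskew
    (fun v hv w hw => ((hE v hv w).2 hw).2) (v := v) hv
  obtain ⟨c, hc⟩ := exists_forall_jacobi_eq R A hskew hpair hAinv.1 hAskew hjac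
  have hform := curvature_eq_of_jacobi_eq R A c hskew hbianchi hAskew hc
  have : Nontrivial V := Module.nontrivial_of_finrank_pos (R := ℝ) (by omega)
  obtain ⟨e, he⟩ := exists_norm_eq V zero_le_one
  have he0 : e ≠ 0 := norm_ne_zero_iff.1 (by rw [he]; exact one_ne_zero)
  have hAe0 : A e ≠ 0 := (map_ne_zero_iff A hAinv.1).2 he0
  have hc0 : c ≠ 0 := by
    rintro rfl
    have hAe : ⟪e, A e⟫ = 0 := by linarith [hAskew e e, real_inner_comm e (A e)]
    have hmem := (hE e he (A e)).1 ⟨by rw [real_inner_comm, hAe], fun u => by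
      rw [hc, hAe, real_inner_self_eq_norm_sq, he]; ring⟩
    exact hAe0 (inner_self_eq_zero.1
      ((Submodule.mem_orthogonal _ _).1 hmem _ (Submodule.subset_span (by simp))))
  obtain ⟨b, hb⟩ := exists_eq_smul_of_forall_apply_eq_smul J A hJ2
    (exists_apply_eq_smul_of_kahler (by omega) J hJiso hJ2 A hAskew R
      (fun x y z w => by rw [hpair, hkahler, hpair])
      (div_ne_zero hc0 (three_ne_zero (α := ℝ))) hform)
  have hb0 : b ≠ 0 := by
    rintro rfl
    exact hAe0 (by rw [hb, zero_smul])
  refine ⟨|b|, abs_pos.2 hb0, fun x => ?_, fun v hv => ?_⟩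
  · rw [hb, hb, map_smul, hJ2, smul_smul, smul_neg, sq_abs, neg_smul, sq]
  · have hJv : ‖J v‖ = 1 := by
      rw [norm_eq_sqrt_real_inner, hJiso, ← norm_eq_sqrt_real_inner, hv]
    rw [hb, norm_smul, hJv, mul_one, Real.norm_eq_abs]
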